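/- arXiv:1804.10786 — 9 statements merged into one kernel-verified Lean document; each statement's English description precedes it below -/
import Mathlib

section
/- Two Fort spaces are homeomorphic if and only if there exists a bijection between their underlying sets; that is, if X is a set with the Fort topology with particular point b ∈ X and Y is a set with the Fort topology with particular point c ∈ Y, then X and Y are homeomorphic if and only if there is a bijection from X to Y. -/
open Cardinal Set Filter

universe u v

/-- The topology on `α` is the Fort topology with particular point `b`. -/
def IsFort {α : Type*} [TopologicalSpace α] (b : α) : Prop :=
  ∀ U : Set α, IsOpen U ↔ b ∉ U ∨ (Uᶜ : Set α).Finite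

/-- `S ≈ T` : the subspaces `S` and `T` are homeomorphic. -/
def Homeo {α : Type*} [TopologicalSpace α] (S T : Set α) : Prop :=
  Nonempty (S ≃ₜ T)

/-- `C` can be embedded into `D`: there is `E ⊆ D` with `E ≈ C`. -/
def CanEmbed {α : Type*} [TopologicalSpace α] (C D : Set α) : Prop :=
  ∃ E : Set α, E ⊆ D ∧ Homeo E C

/-- `A` is a `C-(X,D,lam)` Top-design of type 1. -/
def IsTopDesign1 {X : Type u} [TopologicalSpace X] (C D : Set X)
    (lam : Cardinal.{u}) (A : Set (Set X)) : Prop :=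
  (∀ B ∈ A, Homeo B D ∧ Homeo (Bᶜ : Set X) (Dᶜ : Set X)) ∧
  ∀ E : Set X, Homeo E C → #↥{B ∈ A | E ⊆ B} = lam

/-- `A` is a `C-(X,D,lam)` Top-design of type 2. -/
def IsTopDesign2 {X : Type u} [TopologicalSpace X] (C D : Set X)
    (lam : Cardinal.{u}) (A : Set (Set X)) : Prop :=
  (∀ B ∈ A, Homeo B D) ∧
  ∀ E : Set X, Homeo E C → #↥{B ∈ A | E ⊆ B} = lam

/-- `A` is a `C-(X,D,lam)` Top-design of type 3. -/
def IsTopDesign3 {X : Type u} [TopologicalSpace X] (C D : Set X)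
    (lam : Cardinal.{u}) (A : Set (Set X)) : Prop :=
  (∀ B ∈ A, Homeo B D ∧ Homeo (Bᶜ : Set X) (Dᶜ : Set X)) ∧
  ∀ E : Set X, Homeo E C → Homeo (Eᶜ : Set X) (Cᶜ : Set X) →
    #↥{B ∈ A | E ⊆ B} = lam

/-- `A` is a `C-(X,D,lam)` Top-design of type 4. -/
def IsTopDesign4 {X : Type u} [TopologicalSpace X] (C D : Set X)
    (lam : Cardinal.{u}) (A : Set (Set X)) : Prop :=
  (∀ B ∈ A, Homeo B D) ∧
  ∀ E : Set X, Homeo E C → Homeo (Eᶜ : Set X) (Cᶜ : Set X) →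
    #↥{B ∈ A | E ⊆ B} = lam

/-- A bijection matching the particular points of two Fort spaces is continuous. -/
theorem IsFort.continuous_equiv {X : Type*} {Y : Type*} [TopologicalSpace X] [TopologicalSpace Y]
    {b : X} {c : Y} (hX : IsFort b) (hY : IsFort c) (e : X ≃ Y) (he : e b = c) :
    Continuous e := by
  refine continuous_def.2 fun U hU => (hX _).2 ?_
  refine ((hY U).1 hU).imp (fun h => ?_) fun h => ?_
  · rwa [mem_preimage, he]
  · rw [← preimage_compl]
    exact h.preimage e.injective.injOn

theorem fort_homeomorphic_iff_equiv {X : Type u} {Y : Type v}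
    [TopologicalSpace X] [TopologicalSpace Y] (b : X) (c : Y)
    (hX : IsFort b) (hY : IsFort c) :
    Nonempty (X ≃ₜ Y) ↔ Nonempty (X ≃ Y) := by
  classical
  refine ⟨fun ⟨h⟩ => ⟨h.toEquiv⟩, fun ⟨e⟩ => ?_⟩
  let f : X ≃ Y := e.trans (Equiv.swap (e b) c)
  have hf : f b = c := by simp [f]
  exact ⟨{ f with
    continuous_toFun := hX.continuous_equiv hY f hf
    continuous_invFun := hY.continuous_equiv hX f.symm (by simp [← hf]) }⟩
end

section
/- Let X be an infinite set equipped with the Fort topology with particular point b ∈ X. If U, V ⊆ X satisfy U ≈ V and X \ U ≈ X \ V, then b ∈ U if and only if b ∈ V. -/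
open Cardinal Set Filter

universe u v

theorem IsFort.discreteTopology {X : Type*} [TopologicalSpace X] {b : X} (hX : IsFort b)
    {T : Set X} (hT : b ∉ T) : DiscreteTopology T := by
  refine discreteTopology_subtype_iff'.mpr fun y hy => ⟨{y}, ?_, by simpa using hy⟩
  exact (hX _).mpr (Or.inl fun h => hT (h ▸ hy))

theorem IsFort.finite_of_discreteTopology {X : Type*} [TopologicalSpace X] {b : X}
    (hX : IsFort b) {S : Set X} (hS : b ∈ S) [DiscreteTopology S] : S.Finite := by
  obtain ⟨O, hO, h⟩ := discreteTopology_subtype_iff'.mp ‹DiscreteTopology S› b hS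
  have hb : b ∈ O := (h.symm ▸ mem_singleton b : b ∈ O ∩ S).1
  have hfin : (Oᶜ : Set X).Finite := ((hX O).mp hO).resolve_left (not_not_intro hb)
  refine (hfin.insert b).subset fun x hx => ?_
  by_cases hxO : x ∈ O
  · exact Or.inl (h ▸ (⟨hxO, hx⟩ : x ∈ O ∩ S) : x ∈ ({b} : Set X))
  · exact Or.inr hxO

theorem IsFort.finite_of_homeo {X : Type*} [TopologicalSpace X] {b : X} (hX : IsFort b)
    {S T : Set X} (hS : b ∈ S) (hT : b ∉ T) (h : Homeo S T) : S.Finite := by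
  obtain ⟨e⟩ := h
  have := hX.discreteTopology hT
  have := e.isEmbedding.discreteTopology
  exact hX.finite_of_discreteTopology hS

theorem IsFort.mem_of_homeo {X : Type*} [TopologicalSpace X] [Infinite X] {b : X}
    (hX : IsFort b) {U V : Set X} (h1 : Homeo U V) (h2 : Homeo (Uᶜ : Set X) (Vᶜ : Set X))
    (hU : b ∈ U) : b ∈ V := by
  by_contra hV
  have hUfin : U.Finite := hX.finite_of_homeo hU hV h1
  have hVc : (Vᶜ : Set X).Finite := hX.finite_of_homeo hV (not_not_intro hU) (h2.map (·.symm))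
  obtain ⟨e⟩ := h1
  have := hUfin.to_subtype
  have hVfin : V.Finite := Finite.of_equiv U e.toEquiv
  exact infinite_univ (union_compl_self V ▸ hVfin.union hVc)

theorem fort_homeo_mem_iff {X : Type u} [TopologicalSpace X] [Infinite X]
    (b : X) (hX : IsFort b) (U V : Set X)
    (h1 : Homeo U V) (h2 : Homeo (Uᶜ : Set X) (Vᶜ : Set X)) :
    b ∈ U ↔ b ∈ V := by
  exact ⟨hX.mem_of_homeo h1 h2,
    hX.mem_of_homeo (h1.map (·.symm)) (h2.map (·.symm))⟩
end

section
/- Let X be an infinite set equipped with the Fort topology with particular point b ∈ X. If U ⊆ X is infinite with card(U) < card(X) and H ⊆ X, then (U ≈ H and X \ U ≈ X \ H) if and only if (card(U) = card(H) and U ∩ {b} = H ∩ {b}). -/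
open Cardinal Set Filter

universe u v

namespace IsFort

variable {α : Type*} {β : Type*} [TopologicalSpace α] [TopologicalSpace β]

/-- A subspace of a Fort space containing the particular point is a Fort space. -/
theorem subtype {b : α} (hα : IsFort b) {S : Set α} (hb : b ∈ S) :
    IsFort (⟨b, hb⟩ : S) := by
  intro V
  constructor
  · rintro ⟨O, hO, rfl⟩
    refine ((hα O).1 hO).imp id fun hfin => ?_
    exact hfin.preimage Subtype.val_injective.injOn
  · rintro (hV | hV)
    · refine ⟨Subtype.val '' V, (hα _).2 (Or.inl ?_),
        Set.preimage_image_eq V Subtype.val_injective⟩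
      rintro ⟨x, hx, rfl⟩
      exact hV hx
    · refine ⟨(Subtype.val '' Vᶜ)ᶜ, (hα _).2 (Or.inr ?_), ?_⟩
      · rw [compl_compl]
        exact hV.image _
      · rw [Set.preimage_compl, Set.preimage_image_eq _ Subtype.val_injective, compl_compl]

theorem discreteTopology_subtype {b : α} (hα : IsFort b) {S : Set α} (hb : b ∉ S) :
    DiscreteTopology S := by
  refine discreteTopology_iff_forall_isOpen.2 fun V => ⟨Subtype.val '' V, (hα _).2 (Or.inl ?_),
    Set.preimage_image_eq V Subtype.val_injective⟩
  rintro ⟨x, -, rfl⟩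
  exact hb x.2

theorem not_discreteTopology {b : α} (hα : IsFort b) [Infinite α] : ¬ DiscreteTopology α := by
  intro h
  rcases (hα {b}).1 (isOpen_discrete _) with hb | hfin
  · exact hb rfl
  · exact Set.Finite.infinite_compl (Set.finite_singleton b) hfin

theorem discreteTopology_subtype_iff {b : α} (hα : IsFort b) {S : Set α} (hS : S.Infinite) :
    DiscreteTopology S ↔ b ∉ S := by
  refine ⟨fun h hb => ?_, hα.discreteTopology_subtype⟩
  have := hS.to_subtype
  exact (hα.subtype hb).not_discreteTopology h

theorem continuous_of_injective {a : α} {b : β} (hα : IsFort a) (hβ : IsFort b) {f : α → β}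
    (hf : Function.Injective f) (hab : f a = b) : Continuous f := by
  subst hab
  refine ⟨fun O hO => (hα _).2 (((hβ O).1 hO).imp id fun hfin => ?_)⟩
  exact hfin.preimage hf.injOn

/-- Fort spaces of the same cardinality are homeomorphic. -/
theorem nonempty_homeomorph {a : α} {b : β} (hα : IsFort a) (hβ : IsFort b) (e : α ≃ β) :
    Nonempty (α ≃ₜ β) := by
  classical
  let g : α ≃ β := e.trans (Equiv.swap (e a) b)
  have hg : g a = b := by simp [g]
  exact ⟨⟨g, hα.continuous_of_injective hβ g.injective hg,
    hβ.continuous_of_injective hα g.symm.injective (g.symm_apply_eq.2 hg.symm)⟩⟩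

theorem homeo_of_mk_eq {b : α} (hα : IsFort b) {S T : Set α} (hST : #S = #T)
    (hb : b ∈ S ↔ b ∈ T) : Homeo S T := by
  obtain ⟨e⟩ := Cardinal.eq.1 hST
  by_cases hS : b ∈ S
  · exact (hα.subtype hS).nonempty_homeomorph (hα.subtype (hb.1 hS)) e
  · have := hα.discreteTopology_subtype hS
    have := hα.discreteTopology_subtype (mt hb.2 hS)
    exact ⟨⟨e, continuous_of_discreteTopology, continuous_of_discreteTopology⟩⟩

end IsFort

theorem fort_homeo_iff_card {X : Type u} [TopologicalSpace X] [Infinite X]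
    (b : X) (hX : IsFort b) (U H : Set X)
    (hU : U.Infinite) (hcard : #↥U < #X) :
    (Homeo U H ∧ Homeo (Uᶜ : Set X) (Hᶜ : Set X)) ↔
      (#↥U = #↥H ∧ U ∩ {b} = H ∩ {b}) := by
  have hmem : U ∩ {b} = H ∩ {b} ↔ (b ∈ U ↔ b ∈ H) := by
    simp [Set.ext_iff]
  rw [hmem]
  constructor
  · rintro ⟨⟨e⟩, -⟩
    have hH : H.Infinite := by
      have := hU.to_subtype
      exact Set.infinite_coe_iff.1 (e.toEquiv.infinite_iff.1 this)
    refine ⟨Cardinal.mk_congr e.toEquiv, not_iff_not.1 ?_⟩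
    rw [← hX.discreteTopology_subtype_iff hU, ← hX.discreteTopology_subtype_iff hH]
    exact ⟨fun _ => e.symm.isEmbedding.discreteTopology, fun _ => e.isEmbedding.discreteTopology⟩
  · rintro ⟨hUH, hb⟩
    refine ⟨hX.homeo_of_mk_eq hUH hb, hX.homeo_of_mk_eq ?_ (not_congr hb)⟩
    rw [Cardinal.mk_compl_of_infinite U hcard, Cardinal.mk_compl_of_infinite H (hUH ▸ hcard)]
end

section
/- Let X be an infinite set equipped with the Fort topology with particular point b ∈ X, and let C, D be nonempty subsets of X. If for some i ∈ {1,2,3,4} and some nonzero cardinal λ there exists a C-(X,D,λ) Top-design of type i, then card(C) ≤ card(D) and card(C) ≤ card(X). -/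
open Cardinal Set Filter

universe u v

/-- If the members of `A` containing `C` form a set of nonzero cardinality and every member of `A`
is homeomorphic to `D`, then `C` has at most as many points as `D`. -/
theorem card_le_of_mk_blocks_ne_zero {X : Type u} [TopologicalSpace X] {C D : Set X}
    {A : Set (Set X)} (hA : ∀ B ∈ A, Homeo B D) (h : #↥{B ∈ A | C ⊆ B} ≠ 0) : #↥C ≤ #↥D := by
  obtain ⟨B, hBA, hCB⟩ := mk_ne_zero_iff.mp h
  obtain ⟨e⟩ := hA B hBA
  exact (mk_le_mk_of_subset hCB).trans_eq (mk_congr e.toEquiv)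

theorem topDesign_card_le {X : Type u} [TopologicalSpace X] [Infinite X]
    (b : X) (hX : IsFort b) (C D : Set X) (hC : C.Nonempty) (hD : D.Nonempty)
    (h : ∃ lam : Cardinal.{u}, lam ≠ 0 ∧ ∃ A : Set (Set X),
      IsTopDesign1 C D lam A ∨ IsTopDesign2 C D lam A ∨
      IsTopDesign3 C D lam A ∨ IsTopDesign4 C D lam A) :
    #↥C ≤ #↥D ∧ #↥C ≤ #X := by
  refine ⟨?_, mk_set_le C⟩
  obtain ⟨lam, hlam, A, h⟩ := h
  have hCC : Homeo C C := ⟨Homeomorph.refl _⟩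
  have hCC' : Homeo (Cᶜ : Set X) Cᶜ := ⟨Homeomorph.refl _⟩
  rcases h with ⟨hA, h⟩ | ⟨hA, h⟩ | ⟨hA, h⟩ | ⟨hA, h⟩
  · exact card_le_of_mk_blocks_ne_zero (fun B hB => (hA B hB).1) (h C hCC ▸ hlam)
  · exact card_le_of_mk_blocks_ne_zero hA (h C hCC ▸ hlam)
  · exact card_le_of_mk_blocks_ne_zero (fun B hB => (hA B hB).1) (h C hCC hCC' ▸ hlam)
  · exact card_le_of_mk_blocks_ne_zero hA (h C hCC hCC' ▸ hlam)
end

section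
/- Let X be an infinite set equipped with the Fort topology with particular point b ∈ X, and let C, D be nonempty subsets of X with b ∉ C ∪ D. If C is finite, then for no nonzero cardinal λ does there exist a C-(X,D,λ) Top-design of type 1. -/
open Cardinal Set Filter

universe u v

theorem IsFort.discreteTopology_of_notMem {X : Type*} [TopologicalSpace X] {b : X}
    (hX : IsFort b) {S : Set X} (hS : b ∉ S) : DiscreteTopology S := by
  refine discreteTopology_iff_isOpen_singleton.2 fun x => ?_
  refine isOpen_induced_iff.2 ⟨{x.1}, (hX _).2 (Or.inl ?_), ?_⟩
  · rintro rfl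
    exact hS x.2
  · ext y
    simp [Subtype.ext_iff]

theorem IsFort.t1Space {X : Type*} [TopologicalSpace X] {b : X} (hX : IsFort b) : T1Space X :=
  ⟨fun x => ⟨(hX _).2 (Or.inr (by simp))⟩⟩

theorem no_type1_of_finite_of_not_mem {X : Type u} [TopologicalSpace X] [Infinite X]
    (b : X) (hX : IsFort b) (C D : Set X) (hC : C.Nonempty) (hD : D.Nonempty)
    (hb : b ∉ C ∪ D) (hfin : C.Finite) :
    ¬ ∃ lam : Cardinal.{u}, lam ≠ 0 ∧ ∃ A : Set (Set X), IsTopDesign1 C D lam A := by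
  classical
  rintro ⟨lam, hlam, A, hA, hcount⟩
  have hbC : b ∉ C := fun h => hb (Or.inl h)
  have hbD : b ∉ D := fun h => hb (Or.inr h)
  obtain ⟨c, hc⟩ := hC
  have := hX.t1Space
  have := hX.discreteTopology_of_notMem hbC
  have := hX.discreteTopology_of_notMem hbD
  let E : Set X := Equiv.swap b c '' C
  have hbE : b ∈ E := ⟨c, hc, Equiv.swap_apply_right b c⟩
  have : Finite E := (hfin.image _).to_subtype
  have hEC : Homeo E C := ⟨((Equiv.swap b c).image C).symm.toHomeomorphOfDiscrete⟩
  obtain ⟨B, hBA, hEB⟩ : {B ∈ A | E ⊆ B}.Nonempty := by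
    rw [← Set.nonempty_coe_sort, ← Cardinal.mk_ne_zero_iff, hcount E hEC]
    exact hlam
  obtain ⟨⟨f⟩, ⟨g⟩⟩ := hA B hBA
  have hbB : b ∈ B := hEB hbE
  have : DiscreteTopology B := f.symm.discreteTopology
  have : DiscreteTopology (Bᶜ : Set X) := hX.discreteTopology_of_notMem (not_not_intro hbB)
  have : DiscreteTopology (Dᶜ : Set X) := g.discreteTopology
  have hBfin : B.Finite := hX.finite_of_discreteTopology hbB
  have hDcfin : (Dᶜ : Set X).Finite := hX.finite_of_discreteTopology hbD
  have : Finite (Dᶜ : Set X) := hDcfin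
  have hBcfin : (Bᶜ : Set X).Finite := Finite.of_equiv _ g.symm.toEquiv
  exact hBfin.infinite_compl hBcfin
end

section
/- Let X be an infinite set equipped with the Fort topology with particular point b ∈ X, and let C, D be nonempty subsets of X with b ∉ C ∪ D. If C is infinite, card(C) ≤ card(D) and card(C) < card(X), then there exist a nonzero cardinal λ and a C-(X,D,λ) Top-design of type 1. -/
open Cardinal Set Filter

universe u v

namespace IsFort

variable {α : Type*} [TopologicalSpace α] {b : α}

/-- A permutation fixing the particular point of a Fort space is continuous. -/
theorem continuous_of_apply_eq (h : IsFort b) (e : α ≃ α) (he : e b = b) : Continuous e := by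
  refine ⟨fun U hU => ?_⟩
  rw [h] at hU ⊢
  refine hU.imp (fun hbU => by simpa [he] using hbU) fun hfin => ?_
  rw [← preimage_compl]
  exact hfin.preimage e.injective.injOn

/-- A permutation of a Fort space fixing the particular point, as a homeomorphism. -/
def homeomorph (h : IsFort b) (e : α ≃ α) (he : e b = b) : α ≃ₜ α where
  toEquiv := e
  continuous_toFun := h.continuous_of_apply_eq e he
  continuous_invFun := h.continuous_of_apply_eq e.symm (by rw [Equiv.symm_apply_eq, he])

theorem discreteTopology_of_notMem_s7 (h : IsFort b) {s : Set α} (hs : b ∉ s) :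
    DiscreteTopology s := by
  rw [discreteTopology_subtype_iff']
  intro y hy
  refine ⟨{y}, (h _).2 (Or.inl ?_), ?_⟩
  · rintro rfl
    exact hs hy
  · simpa using hy

theorem notMem_of_discreteTopology (h : IsFort b) {s : Set α} (hs : s.Infinite)
    [hd : DiscreteTopology s] : b ∉ s := by
  intro hb
  obtain ⟨U, hU, hUs⟩ := discreteTopology_subtype_iff'.1 hd b hb
  have hbU : b ∈ U := (hUs.symm.subset rfl).1
  have hfin : Uᶜ.Finite := ((h U).1 hU).resolve_left (not_not.2 hbU)
  refine hs ((hfin.union (finite_singleton b)).subset fun x hx => ?_)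
  by_cases hxU : x ∈ U
  · exact Or.inr (hUs.subset ⟨hxU, hx⟩)
  · exact Or.inl hxU

/-- Two equinumerous small subsets of a Fort space avoiding the particular point are exchanged by
a self-homeomorphism. -/
theorem exists_homeomorph_image_eq [Infinite α] (h : IsFort b) {s t : Set α} (hs : b ∉ s)
    (ht : b ∉ t) (hst : #s = #t) (hlt : #s < #α) : ∃ φ : α ≃ₜ α, φ '' s = t := by
  obtain ⟨e⟩ := Cardinal.eq.1 hst
  obtain ⟨g, hg⟩ := extend_function_of_lt (e.toEmbedding.trans (Function.Embedding.subtype _)) hlt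
    ⟨Equiv.refl α⟩
  replace hg : ∀ x : s, g x = e x := hg
  classical
  have key : ∀ x : s, (g.trans (Equiv.swap (g b) b)) x = e x := fun x => by
    rw [Equiv.trans_apply, Equiv.swap_apply_of_ne_of_ne, hg]
    · intro hx
      exact hs (g.injective hx ▸ x.2)
    · intro hx
      rw [hg] at hx
      exact ht (hx ▸ (e x).2)
  refine ⟨h.homeomorph (g.trans (Equiv.swap (g b) b)) (by simp), ?_⟩
  ext y
  constructor
  · rintro ⟨x, hx, rfl⟩
    exact (key ⟨x, hx⟩).symm ▸ (e ⟨x, hx⟩).2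
  · intro hy
    refine ⟨e.symm ⟨y, hy⟩, Subtype.coe_prop _, (key _).trans ?_⟩
    simp

end IsFort

/-- The orbit of `D` under the self-homeomorphisms of the ambient space. -/
def homeomorphOrbit {α : Type*} [TopologicalSpace α] (D : Set α) : Set (Set α) :=
  {B | ∃ φ : α ≃ₜ α, φ '' D = B}

theorem image_mem_homeomorphOrbit {α : Type*} [TopologicalSpace α] {D B : Set α} (φ : α ≃ₜ α)
    (hB : B ∈ homeomorphOrbit D) : φ '' B ∈ homeomorphOrbit D := by
  obtain ⟨ψ, rfl⟩ := hB
  exact ⟨ψ.trans φ, by rw [← image_comp]; rfl⟩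

theorem homeo_of_mem_homeomorphOrbit {α : Type*} [TopologicalSpace α] {D B : Set α}
    (hB : B ∈ homeomorphOrbit D) : Homeo B D ∧ Homeo Bᶜ Dᶜ := by
  obtain ⟨φ, rfl⟩ := hB
  rw [← image_compl_eq φ.bijective]
  exact ⟨⟨(φ.image D).symm⟩, ⟨(φ.image Dᶜ).symm⟩⟩

theorem mk_homeomorphOrbit_superset_le {α : Type*} [TopologicalSpace α] (D E : Set α)
    (φ : α ≃ₜ α) :
    #{B ∈ homeomorphOrbit D | E ⊆ B} ≤ #{B ∈ homeomorphOrbit D | φ '' E ⊆ B} :=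
  mk_le_of_injective
    (f := fun B => ⟨φ '' B.1, image_mem_homeomorphOrbit φ B.2.1, image_mono B.2.2⟩)
    fun _ _ h => Subtype.ext (φ.injective.image_injective (congrArg Subtype.val h))

theorem mk_homeomorphOrbit_superset_image {α : Type*} [TopologicalSpace α] (D E : Set α)
    (φ : α ≃ₜ α) :
    #{B ∈ homeomorphOrbit D | φ '' E ⊆ B} = #{B ∈ homeomorphOrbit D | E ⊆ B} := by
  refine le_antisymm ?_ (mk_homeomorphOrbit_superset_le D E φ)
  simpa [← image_comp] using mk_homeomorphOrbit_superset_le D (φ '' E) φ.symm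

theorem exists_type1_of_infinite_of_not_mem {X : Type u} [TopologicalSpace X] [Infinite X]
    (b : X) (hX : IsFort b) (C D : Set X) (hC : C.Nonempty) (hD : D.Nonempty)
    (hb : b ∉ C ∪ D) (hinf : C.Infinite) (hCD : #↥C ≤ #↥D) (hCX : #↥C < #X) :
    ∃ lam : Cardinal.{u}, lam ≠ 0 ∧ ∃ A : Set (Set X), IsTopDesign1 C D lam A := by
  have hbC : b ∉ C := fun h => hb (Or.inl h)
  refine ⟨#{B ∈ homeomorphOrbit D | C ⊆ B}, ?_, homeomorphOrbit D,
    fun B => homeo_of_mem_homeomorphOrbit, fun E hE => ?_⟩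
  · obtain ⟨F, hFD, hFC⟩ := le_mk_iff_exists_subset.1 hCD
    obtain ⟨φ, rfl⟩ := hX.exists_homeomorph_image_eq (fun h => hb (Or.inr (hFD h))) hbC hFC
      (hFC ▸ hCX)
    exact mk_ne_zero_iff.2 ⟨⟨φ '' D, ⟨φ, rfl⟩, image_mono hFD⟩⟩
  · obtain ⟨e⟩ := hE
    have hEC : #E = #C := mk_congr e.toEquiv
    have := hX.discreteTopology_of_notMem_s7 hbC
    have : DiscreteTopology E := e.symm.discreteTopology
    have : Infinite C := hinf.to_subtype
    have hEinf : E.Infinite := infinite_coe_iff.1 (Infinite.of_injective e.symm e.symm.injective)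
    obtain ⟨φ, rfl⟩ := hX.exists_homeomorph_image_eq (hX.notMem_of_discreteTopology hEinf) hbC hEC
      (hEC ▸ hCX)
    exact (mk_homeomorphOrbit_superset_image D E φ).symm
end

section
/- Let X be an infinite set equipped with the Fort topology with particular point b ∈ X, and let C, D be nonempty subsets of X with b ∈ D. If C is finite, then there exist a nonzero cardinal λ and a C-(X,D,λ) Top-design of type 1 if and only if card(C) + 2 ≤ card(D). -/
open Cardinal Set Filter

universe u v

section Fort

variable {X : Type u} [TopologicalSpace X] {b : X}

theorem IsFort.isOpen_subtype_iff (hX : IsFort b) {S : Set X} (U : Set S) :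
    IsOpen U ↔ ∀ x ∈ U, (x : X) = b → (Uᶜ : Set S).Finite := by
  constructor
  · rintro ⟨V, hV, rfl⟩ x hx rfl
    exact (((hX V).1 hV).resolve_left (not_not.2 hx)).preimage Subtype.val_injective.injOn
  · intro h
    by_cases hb : ∃ x ∈ U, (x : X) = b
    · obtain ⟨x, hx, hxb⟩ := hb
      refine ⟨((↑) '' (Uᶜ : Set S))ᶜ, (hX _).2 (Or.inr ?_), ?_⟩
      · rw [compl_compl]
        exact (h x hx hxb).image _
      · rw [preimage_compl, preimage_image_eq _ Subtype.val_injective, compl_compl]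
    · refine ⟨(↑) '' U, (hX _).2 (Or.inl ?_), preimage_image_eq _ Subtype.val_injective⟩
      rintro ⟨x, hx, hxb⟩
      exact hb ⟨x, hx, hxb⟩

theorem IsFort.homeo_of_equiv (hX : IsFort b) {S T : Set X} (e : S ≃ T)
    (he : ∀ x, (e x : X) = b ↔ (x : X) = b) : Homeo S T := by
  refine ⟨e.toHomeomorph fun U => ?_⟩
  have hfin : (e ⁻¹' Uᶜ).Finite ↔ (Uᶜ : Set T).Finite :=
    ⟨fun h => Finite.of_preimage h e.surjective, fun h => h.preimage e.injective.injOn⟩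
  rw [hX.isOpen_subtype_iff, hX.isOpen_subtype_iff, ← preimage_compl, hfin, ← e.forall_congr_right]
  simp only [mem_preimage, he]

theorem Homeo.mk_eq {S T : Set X} (h : Homeo S T) : #S = #T :=
  mk_congr h.some.toEquiv

theorem IsFort.homeo_of_finite (hX : IsFort b) {S T : Set X} (hS : S.Finite)
    (h : #S = #T) : Homeo S T := by
  obtain ⟨e⟩ := Cardinal.eq.1 h
  have : Finite S := hS
  have : Finite T := Finite.of_equiv S e
  refine ⟨e.toHomeomorph fun U => ?_⟩
  rw [hX.isOpen_subtype_iff, hX.isOpen_subtype_iff]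
  exact iff_of_true (fun _ _ _ => toFinite _) (fun _ _ _ => toFinite _)

theorem IsFort.homeo_of_mem (hX : IsFort b) {S T : Set X} (hS : b ∈ S) (hT : b ∈ T)
    (h : #S = #T) : Homeo S T := by
  classical
  obtain ⟨e⟩ := Cardinal.eq.1 h
  refine hX.homeo_of_equiv (e.trans (Equiv.swap (e ⟨b, hS⟩) ⟨b, hT⟩)) fun x => ?_
  have h1 : (x : X) = b ↔ x = ⟨b, hS⟩ := by rw [Subtype.ext_iff]
  have h2 (y : T) : (y : X) = b ↔ y = ⟨b, hT⟩ := by rw [Subtype.ext_iff]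
  rw [h1, h2, Equiv.trans_apply, Equiv.swap_apply_eq_iff, Equiv.swap_apply_right,
    e.apply_eq_iff_eq]

theorem IsFort.homeo_of_notMem (hX : IsFort b) {S T : Set X} (hS : b ∉ S) (hT : b ∉ T)
    (h : #S = #T) : Homeo S T := by
  obtain ⟨e⟩ := Cardinal.eq.1 h
  exact hX.homeo_of_equiv e fun x =>
    iff_of_false (fun hx => hT (hx ▸ (e x).2)) (fun hx => hS (hx ▸ x.2))

theorem IsFort.notMem_of_homeo (hX : IsFort b) {S T : Set X} (hS : S.Infinite)
    (hT : b ∉ T) (h : Homeo S T) : b ∉ S := by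
  intro hb
  obtain ⟨e⟩ := h
  have hopen : IsOpen (e ⁻¹' {e ⟨b, hb⟩}) := by
    refine IsOpen.preimage e.continuous ((hX.isOpen_subtype_iff _).2 fun x _ hx => ?_)
    exact absurd (hx ▸ x.2) hT
  have hfin := (hX.isOpen_subtype_iff _).1 hopen ⟨b, hb⟩ rfl rfl
  have : (univ : Set S).Finite := by
    rw [← union_compl_self (e ⁻¹' {e ⟨b, hb⟩})]
    exact ((finite_singleton _).preimage e.injective.injOn).union hfin
  exact hS (Set.finite_coe_iff.1 (Set.finite_univ_iff.1 this))

end Fort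

section Counting

variable {X : Type u} [Infinite X]

theorem mk_compl_eq_of_finite {K : Set X} (hK : K.Finite) : #(Kᶜ : Set X) = #X :=
  mk_compl_of_infinite K (hK.lt_aleph0.trans_le (aleph0_le_mk X))

/-- The supersets of a finite set with infinite cardinality `κ` and co-cardinality `μ` are as
many as all such sets. -/
theorem mk_supersets_eq_of_infinite {κ μ : Cardinal.{u}} (hκ : ℵ₀ ≤ κ) {K : Set X}
    (hK : K.Finite) :
    #{B : Set X | #B = κ ∧ #(Bᶜ : Set X) = μ ∧ K ⊆ B} =
      #{B : Set X | #B = κ ∧ #(Bᶜ : Set X) = μ} := by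
  obtain ⟨e⟩ := Cardinal.eq.1 (mk_compl_eq_of_finite hK)
  let f : X → X := fun x => e.symm x
  have hf : Function.Injective f := Subtype.val_injective.comp e.symm.injective
  have hr : range f = Kᶜ := by
    rw [show f = Subtype.val ∘ e.symm from rfl, e.symm.surjective.range_comp,
      Subtype.range_coe]
  have hcompl (S : Set X) : (f '' Sᶜ)ᶜ = f '' S ∪ K := by
    rw [← compl_inj_iff, compl_compl, compl_union, image_compl_eq_range_sdiff_image hf, hr]
    ext; simp [and_comm]
  have hmk (S : Set X) : #(f '' S ∪ K : Set X) = #S + #K := by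
    rw [mk_union_of_disjoint, mk_image_eq hf]
    exact disjoint_left.2 fun x hx hxK => (hr ▸ image_subset_range f S hx : x ∈ Kᶜ) hxK
  have hadd (S : Set X) : #S + #K = κ ↔ #S = κ := by
    have hlt : #K < κ := hK.lt_aleph0.trans_le hκ
    constructor
    · intro h
      have hS : ℵ₀ ≤ #S := by
        by_contra! hS
        exact (add_lt_aleph0 hS hK.lt_aleph0).not_ge (h ▸ hκ)
      rwa [add_eq_left hS (hK.lt_aleph0.le.trans hS)] at h
    · rintro rfl
      exact add_eq_left hκ hlt.le
  have hset : {B : Set X | #B = κ ∧ #(Bᶜ : Set X) = μ ∧ K ⊆ B} =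
      (fun S => f '' S ∪ K) '' {B : Set X | #B = κ ∧ #(Bᶜ : Set X) = μ} := by
    ext B
    constructor
    · rintro ⟨h1, h2, h3⟩
      have hB : f '' (f ⁻¹' B) ∪ K = B := by
        rw [image_preimage_eq_inter_range, hr]
        ext x
        by_cases hx : x ∈ K <;> simp [hx, @h3 x]
      refine ⟨f ⁻¹' B, ⟨?_, ?_⟩, hB⟩
      · rw [← hadd, ← hmk, hB, h1]
      · rw [← hB, ← hcompl, compl_compl, mk_image_eq hf] at h2
        exact h2
    · rintro ⟨S, ⟨h1, h2⟩, rfl⟩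
      refine ⟨by rw [hmk, hadd, h1], ?_, subset_union_right⟩
      dsimp only
      rw [← hcompl, compl_compl, mk_image_eq hf, h2]
  rw [hset]
  refine mk_image_eq_of_injOn _ _ fun S _ T _ h => ?_
  rwa [← hcompl, ← hcompl, compl_inj_iff, hf.image_injective.eq_iff, compl_inj_iff] at h

theorem mk_supersets_eq_of_finite {K : Finset X} {m : ℕ} (hK : K.card < m) :
    #{B : Set X | #B = m ∧ (K : Set X) ⊆ B} = #X := by
  classical
  apply le_antisymm
  · rw [← mk_finset_of_infinite X]
    refine (mk_le_mk_of_subset fun B hB => ?_).trans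
      (mk_range_le (f := fun s : Finset X => (s : Set X)))
    have : B.Finite := lt_aleph0_iff_finite.1 (hB.1 ▸ natCast_lt_aleph0)
    exact ⟨this.toFinset, this.coe_toFinset⟩
  · obtain ⟨J, hKJ, hJ⟩ := Infinite.exists_superset_card_eq K (m - 1) (by omega)
    rw [← mk_compl_eq_of_finite J.finite_toSet]
    refine mk_le_of_injective
      (f := fun x => ⟨((insert (x : X) J : Finset X) : Set X), ?_, ?_⟩) fun x y h => ?_
    · rw [SetLike.coe_sort_coe, mk_coe_finset, Finset.card_insert_of_notMem (mt Finset.mem_coe.2 x.2), hJ]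
      congr 1
      omega
    · exact_mod_cast hKJ.trans (Finset.subset_insert _ _)
    · have hx : (x : X) ∈ insert (y : X) J := by
        have := congrArg Subtype.val h
        rw [← Finset.coe_inj.1 this]
        exact Finset.mem_insert_self _ _
      exact Subtype.ext ((Finset.mem_insert.1 hx).resolve_right (mt Finset.mem_coe.2 x.2))

end Counting

theorem IsFort.isTopDesign1_of_mk {X : Type u} [TopologicalSpace X] {b : X} (hX : IsFort b)
    {C D : Set X} (hb : b ∈ D) {lam : Cardinal.{u}}
    (h : ∀ E : Set X, #E = #C →
      #{B : Set X | #B = #D ∧ #(Bᶜ : Set X) = #(Dᶜ : Set X) ∧ insert b E ⊆ B} = lam) :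
    IsTopDesign1 C D lam {B | b ∈ B ∧ #B = #D ∧ #(Bᶜ : Set X) = #(Dᶜ : Set X)} := by
  refine ⟨fun B ⟨h1, h2, h3⟩ => ⟨hX.homeo_of_mem h1 hb h2,
    hX.homeo_of_notMem (not_not.2 h1) (not_not.2 hb) h3⟩, fun E hE => ?_⟩
  rw [← h E hE.mk_eq]
  congr 2
  ext B
  simp only [mem_ofPred_eq, insert_subset_iff]
  tauto

theorem IsTopDesign1.card_add_two_le {X : Type u} [TopologicalSpace X] [Infinite X] {b : X}
    (hX : IsFort b) {C D : Set X} (hC : C.Nonempty) (hb : b ∈ D) (hfin : C.Finite)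
    (hD : D.Finite) {lam : Cardinal.{u}} (hlam : lam ≠ 0) {A : Set (Set X)}
    (hA : IsTopDesign1 C D lam A) : C.ncard + 2 ≤ D.ncard := by
  classical
  have hmem (B) (hB : B ∈ A) : b ∈ B ∧ B.Finite ∧ B.ncard = D.ncard := by
    obtain ⟨⟨e⟩, hc⟩ := hA.1 B hB
    have : Finite D := hD
    have hBfin : B.Finite := Finite.of_equiv D e.toEquiv.symm
    exact ⟨not_not.1 (hX.notMem_of_homeo hBfin.infinite_compl (not_not.2 hb) hc), hBfin,
      Set.ncard_congr' e.toEquiv⟩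
  have hmk (E : Finset X) (hE : E.card = C.ncard) : #{B ∈ A | (E : Set X) ⊆ B} = lam := by
    refine hA.2 E (hX.homeo_of_finite E.finite_toSet ?_)
    rw [SetLike.coe_sort_coe, mk_coe_finset, hE, Set.cast_ncard hfin]
  have hex (E : Finset X) (hE : E.card = C.ncard) : ∃ B ∈ A, (E : Set X) ⊆ B := by
    have := mk_ne_zero_iff.1 (hmk E hE ▸ hlam)
    exact ⟨this.some, this.some.2⟩
  by_contra! hlt
  have heq (S : Finset X) (hS : S.card = C.ncard + 1) (hbS : b ∈ S) (B) (hB : B ∈ A)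
      (hEB : ((S.erase b : Finset X) : Set X) ⊆ B) : B = S := by
    obtain ⟨h1, h2, h3⟩ := hmem B hB
    have hsub : (S : Set X) ⊆ B := by
      rw [← Finset.insert_erase hbS, Finset.coe_insert]
      exact insert_subset h1 hEB
    refine (eq_of_subset_of_ncard_le hsub ?_ h2).symm
    rw [ncard_coe_finset]
    omega
  have hex' (S : Finset X) (hS : S.card = C.ncard + 1) (hbS : b ∈ S) : (S : Set X) ∈ A := by
    obtain ⟨B, hB, hEB⟩ := hex (S.erase b) (by rw [Finset.card_erase_of_mem hbS, hS]; rfl)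
    exact heq S hS hbS B hB hEB ▸ hB
  have hpos : 0 < C.ncard := (ncard_pos hfin).2 hC
  obtain ⟨S, hbS, hS⟩ := Infinite.exists_superset_card_eq {b} (C.ncard + 2) (by simp)
  replace hbS : b ∈ S := hbS (Finset.mem_singleton_self b)
  obtain ⟨x, hx, y, hy, hxy⟩ := Finset.one_lt_card.1
    (show 1 < (S.erase b).card by rw [Finset.card_erase_of_mem hbS]; omega)
  rw [Finset.mem_erase] at hx hy
  have hcx : (S.erase x).card = C.ncard + 1 := by rw [Finset.card_erase_of_mem hx.2, hS]; rfl
  have hcy : (S.erase y).card = C.ncard + 1 := by rw [Finset.card_erase_of_mem hy.2, hS]; rfl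
  have hbx : b ∈ S.erase x := Finset.mem_erase.2 ⟨hx.1.symm, hbS⟩
  have hby : b ∈ S.erase y := Finset.mem_erase.2 ⟨hy.1.symm, hbS⟩
  have hlam1 : lam ≤ 1 := by
    rw [← hmk ((S.erase x).erase b) (by rw [Finset.card_erase_of_mem hbx, hcx]; rfl),
      le_one_iff_subsingleton]
    exact ⟨fun B B' => Subtype.ext ((heq _ hcx hbx _ B.2.1 B.2.2).trans
      (heq _ hcx hbx _ B'.2.1 B'.2.2).symm)⟩
  rw [← hmk ((S.erase x).erase y) (by
      rw [Finset.card_erase_of_mem (Finset.mem_erase.2 ⟨hxy.symm, hy.2⟩), hcx]; rfl),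
    le_one_iff_subsingleton] at hlam1
  have h1 : (S.erase x : Set X) = S.erase y := congrArg Subtype.val (hlam1.elim
    ⟨_, hex' _ hcx hbx, Finset.coe_subset.2 (Finset.erase_subset _ _)⟩
    ⟨_, hex' _ hcy hby, Finset.coe_subset.2
      (Finset.erase_subset_erase _ (Finset.erase_subset _ _))⟩)
  have : x ∈ S.erase y := Finset.mem_erase.2 ⟨hxy, hx.2⟩
  rw [← Finset.coe_inj.1 h1] at this
  exact Finset.notMem_erase x S this

theorem exists_type1_iff_card_add_two_le {X : Type u} [TopologicalSpace X] [Infinite X]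
    (b : X) (hX : IsFort b) (C D : Set X) (hC : C.Nonempty) (hD : D.Nonempty)
    (hb : b ∈ D) (hfin : C.Finite) :
    (∃ lam : Cardinal.{u}, lam ≠ 0 ∧ ∃ A : Set (Set X), IsTopDesign1 C D lam A) ↔
      #↥C + 2 ≤ #↥D := by
  classical
  have hEfin (E : Set X) (hE : #E = #C) : E.Finite :=
    lt_aleph0_iff_finite.1 (hE ▸ hfin.lt_aleph0)
  by_cases hDfin : D.Finite
  · rw [← Set.cast_ncard hfin, ← Set.cast_ncard hDfin]
    norm_cast
    constructor
    · rintro ⟨lam, hlam, A, hA⟩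
      exact hA.card_add_two_le hX hC hb hfin hDfin hlam
    · intro h
      refine ⟨#X, mk_ne_zero X, _, hX.isTopDesign1_of_mk hb fun E hE => ?_⟩
      have hEf := hEfin E hE
      have hcard : (insert b hEf.toFinset).card < D.ncard := by
        have h1 := Finset.card_insert_le b hEf.toFinset
        have h2 : hEf.toFinset.card = C.ncard := by
          rw [← ncard_eq_toFinset_card E hEf, ← Nat.cast_inj (R := Cardinal.{u}),
            Set.cast_ncard hEf, Set.cast_ncard hfin, hE]
        omega
      rw [← mk_supersets_eq_of_finite hcard]
      congr 2
      ext B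
      rw [Set.cast_ncard hDfin, mem_ofPred_eq, mem_ofPred_eq, Finset.coe_insert,
        hEf.coe_toFinset]
      refine and_congr_right fun hB => and_iff_right ?_
      rw [mk_compl_eq_of_finite hDfin,
        mk_compl_eq_of_finite (lt_aleph0_iff_finite.1 (hB ▸ hDfin.lt_aleph0))]
  · have hκ : ℵ₀ ≤ #D := infinite_iff.1 (infinite_coe_iff.2 hDfin)
    refine iff_of_true ⟨_, ?_, _, hX.isTopDesign1_of_mk hb fun E hE =>
      mk_supersets_eq_of_infinite hκ ((hEfin E hE).insert b)⟩ ?_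
    · exact mk_ne_zero_iff.2 ⟨⟨D, rfl, rfl⟩⟩
    · exact (add_lt_aleph0 hfin.lt_aleph0 (natCast_lt_aleph0 (n := 2))).le.trans hκ
end

section
/- Let X be an infinite set equipped with the Fort topology with particular point b ∈ X, and let C, D be nonempty subsets of X with b ∈ D. If C is infinite, card(C) ≤ card(D) and card(C) < card(X), then there exist a nonzero cardinal λ and a C-(X,D,λ) Top-design of type 1. -/
open Cardinal Set Filter

universe u v

theorem exists_perm_image_eq_of_mk_eq {α : Type u} [Infinite α] {b : α} {E F : Set α}
    (hEF : #E = #F) (hE : #E < #α) (hb : b ∈ E ↔ b ∈ F) :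
    ∃ σ : Equiv.Perm α, σ b = b ∧ σ '' E = F := by
  classical
  obtain ⟨e⟩ := Cardinal.eq.1 hEF
  have hc : #(Eᶜ : Set α) = #(Fᶜ : Set α) := by
    rw [Cardinal.mk_compl_of_infinite E hE, Cardinal.mk_compl_of_infinite F (hEF ▸ hE)]
  obtain ⟨e'⟩ := Cardinal.eq.1 hc
  let τ : Equiv.Perm α :=
    (Equiv.Set.sumCompl E).symm.trans ((Equiv.sumCongr e e').trans (Equiv.Set.sumCompl F))
  have hτ : ∀ x, τ x ∈ F ↔ x ∈ E := by
    intro x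
    by_cases hx : x ∈ E
    · simp [τ, Equiv.Set.sumCompl_symm_apply_of_mem hx, hx]
    · have hx' : (e' ⟨x, hx⟩ : α) ∉ F := (e' ⟨x, hx⟩).2
      simp [τ, Equiv.Set.sumCompl_symm_apply_of_notMem hx, hx, hx']
  have hmem : ∀ x, Equiv.swap (τ b) b (τ x) ∈ F ↔ x ∈ E := by
    intro x
    rw [← hτ x]
    have hbF : τ b ∈ F ↔ b ∈ F := (hτ b).trans hb
    rcases eq_or_ne (τ x) (τ b) with h | h
    · rw [h, Equiv.swap_apply_left, hbF]
    · rcases eq_or_ne (τ x) b with h' | h'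
      · rw [h', Equiv.swap_apply_right, hbF]
      · rw [Equiv.swap_apply_of_ne_of_ne h h']
  refine ⟨τ.trans (Equiv.swap (τ b) b), by simp, ?_⟩
  ext y
  rw [Equiv.image_eq_preimage_symm, mem_preimage, ← hmem]
  have := (τ.trans (Equiv.swap (τ b) b)).apply_symm_apply y
  rw [Equiv.trans_apply] at this
  rw [this]

namespace IsFort

theorem continuous_perm {α : Type*} [TopologicalSpace α] {b : α} (h : IsFort b)
    (σ : Equiv.Perm α) (hσ : σ b = b) : Continuous σ := by
  refine continuous_def.2 fun U hU => (h _).2 ?_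
  refine ((h U).1 hU).imp (fun hbU => by simpa [hσ] using hbU) fun hf => ?_
  rw [← preimage_compl]
  exact hf.preimage σ.injective.injOn

theorem exists_homeomorph_image_eq_s11 {α : Type u} [TopologicalSpace α] [Infinite α] {b : α}
    (h : IsFort b) {E F : Set α} (hEF : #E = #F) (hE : #E < #α) (hb : b ∈ E ↔ b ∈ F) :
    ∃ σ : α ≃ₜ α, σ '' E = F := by
  obtain ⟨σ, hσ, himg⟩ := exists_perm_image_eq_of_mk_eq hEF hE hb
  refine ⟨⟨σ, h.continuous_perm σ hσ, h.continuous_perm σ.symm ?_⟩, himg⟩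
  rw [Equiv.symm_apply_eq, hσ]

theorem discreteTopology_iff {α : Type*} [TopologicalSpace α] {b : α} (h : IsFort b)
    {S : Set α} (hS : S.Infinite) : DiscreteTopology S ↔ b ∉ S := by
  constructor
  · intro hd hbS
    obtain ⟨U, hU, hUS⟩ := isOpen_induced_iff.1 (isOpen_discrete ({⟨b, hbS⟩} : Set S))
    have hbU : b ∈ U := by
      have : (⟨b, hbS⟩ : S) ∈ Subtype.val ⁻¹' U := hUS ▸ mem_singleton _
      exact this
    have hf : Uᶜ.Finite := ((h U).1 hU).resolve_left (not_not.2 hbU)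
    refine hS ((hf.insert b).subset fun x hx => ?_)
    by_cases hxU : x ∈ U
    · have : (⟨x, hx⟩ : S) ∈ ({⟨b, hbS⟩} : Set S) := hUS ▸ hxU
      exact Or.inl (congrArg Subtype.val this)
    · exact Or.inr hxU
  · intro hbS
    refine discreteTopology_iff_forall_isOpen.2 fun V => isOpen_induced_iff.2
      ⟨Subtype.val '' V, (h _).2 (Or.inl ?_), preimage_image_eq V Subtype.val_injective⟩
    rintro ⟨x, -, rfl⟩
    exact hbS x.2

theorem mem_iff_of_homeo {α : Type*} [TopologicalSpace α] {b : α} (h : IsFort b)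
    {S T : Set α} (hT : T.Infinite) (hST : Homeo S T) : b ∈ S ↔ b ∈ T := by
  obtain ⟨e⟩ := hST
  have hS : S.Infinite := by
    rw [← infinite_coe_iff] at hT ⊢
    exact e.toEquiv.infinite_iff.2 hT
  rw [← not_iff_not, ← h.discreteTopology_iff hS, ← h.discreteTopology_iff hT]
  exact ⟨fun _ => e.symm.isEmbedding.discreteTopology, fun _ => e.isEmbedding.discreteTopology⟩

end IsFort

theorem exists_subset_mk_eq_and_mem_iff {α : Type u} {b : α} {C D : Set α} (hb : b ∈ D)
    (hC : C.Infinite) (hCD : #C ≤ #D) : ∃ E ⊆ D, #E = #C ∧ (b ∈ E ↔ b ∈ C) := by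
  obtain ⟨E, hED, hE⟩ := Cardinal.le_mk_iff_exists_subset.1 hCD
  have hC' : ℵ₀ ≤ #C := Cardinal.infinite_iff.1 hC.to_subtype
  have hinf : E.Infinite := by
    rw [← infinite_coe_iff, Cardinal.infinite_iff, hE]
    exact hC'
  have hdiff : #(E \ {b} : Set α) + 1 = #(insert b E : Set α) := by
    rw [← insert_sdiff_singleton, Cardinal.mk_insert (by simp)]
  have hdiff' : #(E \ {b} : Set α) + 1 = #(E \ {b} : Set α) :=
    Cardinal.add_one_eq (Cardinal.infinite_iff.1 (hinf.sdiff (finite_singleton b)).to_subtype)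
  have hle : #(E \ {b} : Set α) ≤ #E := Cardinal.mk_le_mk_of_subset sdiff_subset
  have hge : #E ≤ #(insert b E : Set α) := Cardinal.mk_le_mk_of_subset (subset_insert b E)
  have heq : #(E \ {b} : Set α) = #(insert b E : Set α) := hdiff'.symm.trans hdiff
  by_cases hbC : b ∈ C
  · exact ⟨insert b E, insert_subset hb hED, ((heq ▸ hle).antisymm hge).trans hE, by simp [hbC]⟩
  · exact ⟨E \ {b}, sdiff_subset.trans hED, (hle.antisymm (heq ▸ hge)).trans hE, by simp [hbC]⟩

theorem exists_type1_of_infinite_of_mem {X : Type u} [TopologicalSpace X] [Infinite X]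
    (b : X) (hX : IsFort b) (C D : Set X) (hC : C.Nonempty) (hD : D.Nonempty)
    (hb : b ∈ D) (hinf : C.Infinite) (hCD : #↥C ≤ #↥D) (hCX : #↥C < #X) :
    ∃ lam : Cardinal.{u}, lam ≠ 0 ∧ ∃ A : Set (Set X), IsTopDesign1 C D lam A := by
  have hmk : ∀ E : Set X, Homeo E C → ∃ σ : X ≃ₜ X, σ '' E = C := fun E hE => by
    have hcard : #E = #C := Cardinal.mk_congr hE.some.toEquiv
    exact hX.exists_homeomorph_image_eq_s11 hcard (hcard ▸ hCX) (hX.mem_iff_of_homeo hinf hE)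
  let A : Set (Set X) := {B | ∃ σ : X ≃ₜ X, σ '' D = B}
  have hA : ∀ (σ : X ≃ₜ X), ∀ B ∈ A, σ '' B ∈ A := by
    rintro σ _ ⟨τ, rfl⟩
    exact ⟨τ.trans σ, by rw [← image_comp]; rfl⟩
  have hle : ∀ (σ : X ≃ₜ X) (E : Set X),
      #↥{B ∈ A | E ⊆ B} ≤ #↥{B ∈ A | σ '' E ⊆ B} := fun σ E =>
    Cardinal.mk_le_of_injective
      (f := fun B => ⟨σ '' B.1, hA σ B.1 B.2.1, image_mono B.2.2⟩) fun B B' h =>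
        Subtype.ext (σ.injective.image_injective (congrArg Subtype.val h))
  refine ⟨#↥{B ∈ A | C ⊆ B}, ?_, A, ?_, ?_⟩
  · obtain ⟨E, hED, hEC, hbE⟩ := exists_subset_mk_eq_and_mem_iff hb hinf hCD
    obtain ⟨σ, rfl⟩ := hX.exists_homeomorph_image_eq_s11 hEC (hEC ▸ hCX) hbE
    exact Cardinal.mk_ne_zero_iff.2 ⟨⟨σ '' D, ⟨σ, rfl⟩, image_mono hED⟩⟩
  · rintro _ ⟨σ, rfl⟩
    refine ⟨⟨(σ.image D).symm⟩, ?_⟩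
    rw [← image_compl_eq σ.bijective]
    exact ⟨(σ.image Dᶜ).symm⟩
  · intro E hE
    obtain ⟨σ, rfl⟩ := hmk E hE
    refine (hle σ E).antisymm ((hle σ.symm _).trans_eq ?_)
    rw [← image_comp, σ.symm_comp_self, image_id]
end

section
/- Let X be an infinite set equipped with the Fort topology with particular point b ∈ X, and let C, D be nonempty subsets of X. Then there exist a nonzero cardinal λ and a C-(X,D,λ) Top-design of type 3 if and only if b ∉ C \ D, card(C \ {b}) ≤ card(D \ {b}), and card(X \ (D ∪ {b})) ≤ card(X \ (C ∪ {b})). -/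
open Cardinal Set Filter

universe u v

/-- In a Fort space, a homeomorphism from an infinite subspace preserves membership of `b`. -/
theorem IsFort.mem_of_homeomorph {X : Type*} [TopologicalSpace X] {b : X} (hX : IsFort b)
    {S T : Set X} (h : S ≃ₜ T) (hS : S.Infinite) (hb : b ∈ S) : b ∈ T := by
  by_contra hbT
  have h1 : IsOpen ({h ⟨b, hb⟩} : Set T) := by
    refine ⟨{(h ⟨b, hb⟩ : X)}, (hX _).2 (Or.inl ?_), ?_⟩
    · intro hmem
      exact hbT ((mem_singleton_iff.1 hmem) ▸ (h ⟨b, hb⟩).2)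
    · ext x
      simp [Subtype.ext_iff]
  obtain ⟨U, hU, hUe⟩ := h1.preimage h.continuous
  have hmem : ∀ x : S, (x : X) ∈ U ↔ (x : X) = b := by
    intro x
    have hx := Set.ext_iff.1 hUe x
    simpa [Subtype.ext_iff] using hx
  rcases (hX U).1 hU with hbU | hfin
  · exact hbU ((hmem ⟨b, hb⟩).2 rfl)
  · refine hS ((hfin.union (finite_singleton b)).subset fun x hx => ?_)
    by_cases hxU : x ∈ U
    · exact Or.inr ((hmem ⟨x, hx⟩).1 hxU)
    · exact Or.inl hxU

theorem IsFort.mem_iff_of_homeo_s15 {X : Type*} [TopologicalSpace X] [Infinite X] {b : X}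
    (hX : IsFort b) {E C : Set X} (h : Homeo E C) (h' : Homeo Eᶜ Cᶜ) : b ∈ E ↔ b ∈ C := by
  obtain ⟨f⟩ := h
  obtain ⟨g⟩ := h'
  by_cases hE : E.Infinite
  · have hC : C.Infinite := by
      rw [← Set.infinite_coe_iff] at hE ⊢
      exact f.toEquiv.infinite_iff.1 hE
    exact ⟨hX.mem_of_homeomorph f hE, hX.mem_of_homeomorph f.symm hC⟩
  · have hE' : Eᶜ.Infinite := (Set.not_infinite.1 hE).infinite_compl
    have hC' : Cᶜ.Infinite := by
      rw [← Set.infinite_coe_iff] at hE' ⊢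
      exact g.toEquiv.infinite_iff.1 hE'
    exact not_iff_not.1 ⟨hX.mem_of_homeomorph g hE', hX.mem_of_homeomorph g.symm hC'⟩

theorem IsFort.continuous_perm_s15 {X : Type*} [TopologicalSpace X] {b : X} (hX : IsFort b)
    (σ : Equiv.Perm X) (hσ : σ b = b) : Continuous σ := by
  refine ⟨fun U hU => ?_⟩
  rw [hX] at hU ⊢
  rcases hU with hU | hU
  · exact Or.inl (by simpa [hσ] using hU)
  · exact Or.inr (by simpa using hU.preimage σ.injective.injOn)

theorem IsFort.homeo_image {X : Type*} [TopologicalSpace X] {b : X} (hX : IsFort b)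
    (σ : Equiv.Perm X) (hσ : σ b = b) (S : Set X) : Homeo S (σ '' S) :=
  ⟨Homeomorph.image ⟨σ, hX.continuous_perm_s15 σ hσ,
    hX.continuous_perm_s15 σ.symm (σ.symm_apply_eq.2 hσ.symm)⟩ S⟩

theorem exists_perm_image_eq {X : Type*} {b : X} {E C : Set X} (h : #E = #C)
    (h' : #↥Eᶜ = #↥Cᶜ) (hb : b ∈ E ↔ b ∈ C) :
    ∃ σ : Equiv.Perm X, σ b = b ∧ σ '' E = C := by
  classical
  obtain ⟨f⟩ := Cardinal.eq.1 h
  obtain ⟨g⟩ := Cardinal.eq.1 h'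
  let τ : Equiv.Perm X :=
    (Equiv.Set.sumCompl E).symm.trans ((Equiv.sumCongr f g).trans (Equiv.Set.sumCompl C))
  have hτ : ∀ x, τ x ∈ C ↔ x ∈ E := by
    intro x
    by_cases hx : x ∈ E
    · simp [τ, hx, Equiv.Set.sumCompl_symm_apply_of_mem hx]
    · have hg : (g ⟨x, hx⟩ : X) ∉ C := (g ⟨x, hx⟩).2
      simpa [τ, hx, Equiv.Set.sumCompl_symm_apply_of_notMem hx] using hg
  have hs : ∀ y, Equiv.swap (τ b) b y ∈ C ↔ y ∈ C := by
    intro y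
    have := hτ b
    rw [Equiv.swap_apply_def]
    split_ifs with h1 h2
    · subst h1; tauto
    · subst h2; tauto
    · rfl
  refine ⟨τ.trans (Equiv.swap (τ b) b), by simp, ?_⟩
  ext y
  rw [Equiv.image_eq_preimage_symm, mem_preimage, ← hτ, ← hs]
  simp

/-- The pairs `(E, Eᶜ)` and `(C, Cᶜ)` are homeomorphic in a Fort space iff some permutation
fixing `b` carries `E` to `C`. -/
theorem IsFort.homeo_and_homeo_compl_iff {X : Type*} [TopologicalSpace X] [Infinite X] {b : X}
    (hX : IsFort b) {E C : Set X} :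
    Homeo E C ∧ Homeo Eᶜ Cᶜ ↔ ∃ σ : Equiv.Perm X, σ b = b ∧ σ '' E = C := by
  constructor
  · rintro ⟨h, h'⟩
    exact exists_perm_image_eq (Cardinal.eq.2 ⟨h.some.toEquiv⟩) (Cardinal.eq.2 ⟨h'.some.toEquiv⟩)
      (hX.mem_iff_of_homeo_s15 h h')
  · rintro ⟨σ, hσ, rfl⟩
    refine ⟨hX.homeo_image σ hσ E, ?_⟩
    rw [← image_compl_eq σ.bijective]
    exact hX.homeo_image σ hσ Eᶜ

theorem Cardinal.exists_add_eq_add_eq {c c' d d' : Cardinal.{u}} (h : c + c' = d + d')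
    (hinf : ℵ₀ ≤ c + c') (hcd : c ≤ d) (hdc : d' ≤ c') : ∃ p, c' = p + d' ∧ c + p = d := by
  have hmax : ∀ {x y : Cardinal.{u}}, c + c' = x + y → x = c + c' ∨ y = c + c' := by
    intro x y hxy
    rw [hxy] at hinf ⊢
    rcases Cardinal.aleph0_le_add_iff.1 hinf with hx | hy
    · rw [Cardinal.add_eq_max hx]
      rcases max_choice x y with e | e <;> simp [e]
    · rw [Cardinal.add_eq_max' hy]
      rcases max_choice x y with e | e <;> simp [e]
  set κ := c + c' with hκ
  have hd'κ : d' ≤ κ := h ▸ self_le_add_left d' d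
  have hc'κ : c' ≤ κ := self_le_add_left c' c
  by_cases hd : d = κ
  · by_cases hc : c = κ
    · obtain ⟨p, hp⟩ := exists_add_of_le hdc
      refine ⟨p, by rw [hp, add_comm], ?_⟩
      rw [hd, hc]
      exact Cardinal.add_eq_left hinf (le_trans (hp ▸ self_le_add_left p d') hc'κ)
    · have hc' : c' = κ := (hmax rfl).resolve_left hc
      refine ⟨κ, ?_, ?_⟩
      · rw [Cardinal.add_eq_left hinf hd'κ, hc']
      · rw [hd]
        exact Cardinal.add_eq_right hinf (hcd.trans_eq hd)
  · have hd' : d' = κ := (hmax h).resolve_left hd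
    have hc' : c' = κ := le_antisymm hc'κ (hd' ▸ hdc)
    obtain ⟨p, hp⟩ := exists_add_of_le hcd
    refine ⟨p, ?_, hp.symm⟩
    rw [hc', hd']
    refine (Cardinal.add_eq_right hinf ?_).symm
    exact (hp ▸ self_le_add_left p c : p ≤ d).trans (h ▸ self_le_add_right d d')

theorem exists_subset_mk_eq_mk_diff_eq {X : Type u} {t : Set X} {p q : Cardinal.{u}}
    (h : #t = p + q) : ∃ Q ⊆ t, #Q = q ∧ #↥(t \ Q) = p := by
  induction p using Cardinal.inductionOn with | _ P
  induction q using Cardinal.inductionOn with | _ R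
  rw [Cardinal.add_def] at h
  obtain ⟨e⟩ := Cardinal.eq.1 h.symm
  have hi : Function.Injective fun x => (e x : X) := Subtype.val_injective.comp e.injective
  refine ⟨range fun r => (e (Sum.inr r) : X), ?_, ?_, ?_⟩
  · rintro _ ⟨r, rfl⟩
    exact (e _).2
  · exact Cardinal.mk_range_eq _ (hi.comp Sum.inr_injective)
  · have : t \ range (fun r => (e (Sum.inr r) : X)) = range fun r => (e (Sum.inl r) : X) := by
      ext x
      constructor
      · rintro ⟨hx, hx'⟩
        obtain ⟨y, hy⟩ := e.surjective ⟨x, hx⟩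
        rcases y with y | y
        · exact ⟨y, by simp [hy]⟩
        · exact absurd ⟨y, by simp [hy]⟩ hx'
      · rintro ⟨y, rfl⟩
        refine ⟨(e _).2, ?_⟩
        rintro ⟨z, hz⟩
        exact absurd (hi hz) (by simp)
    rw [this]
    exact Cardinal.mk_range_eq _ (hi.comp Sum.inl_injective)

theorem mk_diff_singleton_add_mk_compl {X : Type u} (b : X) (C : Set X) :
    #↥(C \ {b}) + #↥(C ∪ {b})ᶜ = #↥({b}ᶜ : Set X) := by
  rw [← Cardinal.mk_union_of_disjoint]
  · congr 2
    ext x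
    simp only [mem_union, Set.mem_sdiff, mem_singleton_iff, mem_compl_iff]
    tauto
  · rw [Set.disjoint_left]
    rintro x ⟨hx, -⟩ hx'
    exact hx' (Or.inl hx)

theorem mk_eq_of_mk_diff_singleton_eq {X : Type u} {b : X} {B D : Set X} (hb : b ∈ B ↔ b ∈ D)
    (h : #↥(B \ {b}) = #↥(D \ {b})) : #B = #D := by
  by_cases hB : b ∈ B
  · have hD := hb.1 hB
    have key : ∀ {S : Set X}, b ∈ S → #S = #↥(S \ {b}) + 1 := by
      intro S hS
      rw [← Cardinal.mk_insert (by simp : b ∉ S \ {b}), insert_sdiff_singleton,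
        insert_eq_of_mem hS]
    rw [key hB, key hD, h]
  · rwa [sdiff_singleton_eq_self hB, sdiff_singleton_eq_self (fun hD => hB (hb.2 hD))] at h

/-- Under the numerical conditions, `C` sits inside a copy of `D` under a permutation
fixing `b`. -/
theorem exists_perm_image_eq_superset {X : Type u} [Infinite X] {b : X} {C D : Set X}
    (hb : b ∉ C \ D) (h : #↥(C \ {b}) ≤ #↥(D \ {b})) (h' : #↥(D ∪ {b})ᶜ ≤ #↥(C ∪ {b})ᶜ) :
    ∃ B : Set X, C ⊆ B ∧ ∃ σ : Equiv.Perm X, σ b = b ∧ σ '' B = D := by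
  have hinf : ℵ₀ ≤ #↥({b}ᶜ : Set X) := by
    rw [Cardinal.aleph0_le_mk_iff, Set.infinite_coe_iff]
    exact (finite_singleton b).infinite_compl
  obtain ⟨p, hp, hp'⟩ := Cardinal.exists_add_eq_add_eq
    ((mk_diff_singleton_add_mk_compl b C).trans (mk_diff_singleton_add_mk_compl b D).symm)
    (by rwa [mk_diff_singleton_add_mk_compl]) h h'
  obtain ⟨Q, hQ, hQd, hQp⟩ := exists_subset_mk_eq_mk_diff_eq hp
  have hbQ : b ∉ Q := fun hmem => hQ hmem (Or.inr rfl)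
  have hCQ : ∀ x ∈ C, x ∉ Q := fun x hx hmem => hQ hmem (Or.inl hx)
  let B : Set X := {x | x ∉ Q ∧ (x = b → b ∈ D)}
  have hBD : b ∈ B ↔ b ∈ D := by simp [B, hbQ]
  have hB : B \ {b} = (C \ {b}) ∪ ((C ∪ {b})ᶜ \ Q) := by
    ext x
    have := hCQ x
    simp only [B, Set.mem_sdiff, mem_ofPred_eq, mem_singleton_iff, mem_union, mem_compl_iff]
    tauto
  have hB' : Bᶜ \ {b} = Q := by
    ext x
    have : x = b → x ∉ Q := by rintro rfl; exact hbQ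
    simp only [B, Set.mem_sdiff, mem_ofPred_eq, mem_singleton_iff, mem_compl_iff]
    tauto
  have hD' : Dᶜ \ {b} = (D ∪ {b})ᶜ := by
    rw [compl_union, Set.sdiff_eq]
  refine ⟨B, fun x hx => ⟨hCQ x hx, ?_⟩, exists_perm_image_eq
    (mk_eq_of_mk_diff_singleton_eq hBD ?_)
    (mk_eq_of_mk_diff_singleton_eq (b := b) (not_congr hBD) ?_) hBD⟩
  · rintro rfl
    by_contra hD
    exact hb ⟨hx, hD⟩
  · rw [hB, Cardinal.mk_union_of_disjoint, hQp, hp']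
    rw [Set.disjoint_left]
    rintro x ⟨hx, -⟩ ⟨hx', -⟩
    exact hx' (Or.inl hx)
  · rw [hB', hD', hQd]

theorem exists_type3_iff {X : Type u} [TopologicalSpace X] [Infinite X]
    (b : X) (hX : IsFort b) (C D : Set X) (hC : C.Nonempty) (hD : D.Nonempty) :
    (∃ lam : Cardinal.{u}, lam ≠ 0 ∧ ∃ A : Set (Set X), IsTopDesign3 C D lam A) ↔
      (b ∉ C \ D ∧ #↥(C \ {b} : Set X) ≤ #↥(D \ {b} : Set X) ∧
        #↥((D ∪ {b})ᶜ : Set X) ≤ #↥((C ∪ {b})ᶜ : Set X)) := by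
  constructor
  · rintro ⟨lam, hlam, A, hA, hcount⟩
    have hne : #↥{B ∈ A | C ⊆ B} ≠ 0 := by
      rw [hcount C ⟨Homeomorph.refl _⟩ ⟨Homeomorph.refl _⟩]
      exact hlam
    obtain ⟨⟨B, hBA, hCB⟩⟩ := Cardinal.mk_ne_zero_iff.1 hne
    obtain ⟨σ, hσ, rfl⟩ := hX.homeo_and_homeo_compl_iff.1 (hA B hBA)
    have hσb : σ '' {b} = {b} := by rw [image_singleton, hσ]
    refine ⟨fun hb => hb.2 ⟨b, hCB hb.1, hσ⟩, ?_, ?_⟩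
    · rw [← hσb, ← image_sdiff σ.injective, Cardinal.mk_image_eq σ.injective, hσb]
      exact Cardinal.mk_le_mk_of_subset (sdiff_subset_sdiff_left hCB)
    · nth_rewrite 1 [← hσb]
      rw [← image_union, ← image_compl_eq σ.bijective, Cardinal.mk_image_eq σ.injective]
      exact Cardinal.mk_le_mk_of_subset (compl_subset_compl.2 (union_subset_union_left _ hCB))
  · rintro ⟨hb, h, h'⟩
    let A : Set (Set X) := {B | ∃ σ : Equiv.Perm X, σ b = b ∧ σ '' B = D}
    obtain ⟨B, hCB, hB⟩ := exists_perm_image_eq_superset hb h h'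
    refine ⟨#↥{B ∈ A | C ⊆ B}, Cardinal.mk_ne_zero_iff.2 ⟨⟨B, hB, hCB⟩⟩, A,
      fun B hB => hX.homeo_and_homeo_compl_iff.2 hB, fun E hE hE' => ?_⟩
    obtain ⟨τ, hτ, rfl⟩ := hX.homeo_and_homeo_compl_iff.1 ⟨hE, hE'⟩
    have hτ' : τ.symm b = b := τ.symm_apply_eq.2 hτ.symm
    refine Cardinal.mk_congr ((Equiv.Set.congr τ).subtypeEquiv fun S => ?_)
    refine and_congr ⟨?_, ?_⟩ (image_subset_image_iff τ.injective).symm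
    · rintro ⟨σ, hσ, rfl⟩
      refine ⟨τ.symm.trans σ, by simp [hτ', hσ], ?_⟩
      simp [Equiv.Set.congr, image_image]
    · rintro ⟨σ, hσ, rfl⟩
      exact ⟨τ.trans σ, by simp [hτ, hσ], by simp [Equiv.Set.congr, image_image]⟩
end
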